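/- Let X, Y be compacta. The set of all strict ambiguous representations between X and Y (each being a nonempty closed subset of exp X × exp Y) is a closed subset of the hyperspace exp(exp X × exp Y) with the Vietoris topology and is closed under binary unions; consequently, ordered by inclusion with join given by union, it is a compact Lawson upper semilattice. -/

import Mathlib

open Set Topology

/-- The hyperspace `exp X` of all nonempty closed subsets of `X`. -/
structure Exp (X : Type*) [TopologicalSpace X] where
  carrier : Set X
  isClosed' : IsClosed carrier
  nonempty' : carrier.Nonempty

namespace Exp

variable {X : Type*} [TopologicalSpace X]

/-- The Vietoris topology on `exp X`, generated by the subbase consisting of the sets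
`⟨U⟩ = {F | F ⊆ U}` and `⟨X, U⟩ = {F | F ∩ U ≠ ∅}` for open `U ⊆ X`. -/
instance topologicalSpace : TopologicalSpace (Exp X) :=
  TopologicalSpace.generateFrom
    ({S | ∃ U : Set X, IsOpen U ∧ S = {F : Exp X | F.carrier ⊆ U}} ∪
     {S | ∃ U : Set X, IsOpen U ∧ S = {F : Exp X | (F.carrier ∩ U).Nonempty}})

/-- The whole space `X` as an element of `exp X`. -/
def univ (X : Type*) [TopologicalSpace X] [Nonempty X] : Exp X :=
  ⟨Set.univ, isClosed_univ, Set.univ_nonempty⟩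

/-- Union of two elements of `exp X`. -/
def union (F G : Exp X) : Exp X :=
  ⟨F.carrier ∪ G.carrier, F.isClosed'.union G.isClosed',
    Set.union_nonempty.mpr (Or.inl F.nonempty')⟩

end Exp

section AmbiguousRepresentations

variable {X Y Z : Type*} [TopologicalSpace X] [TopologicalSpace Y] [TopologicalSpace Z]

/-- An ambiguous representation between `X` and `Y`:
(a) antitone in the first argument and isotone in the second;
(b) `(A, Y) ∈ R` for all `A`;
(c) all sets `AR = {B | (A,B) ∈ R}` are closed in the Vietoris topology. -/
def IsAmbRep [Nonempty Y] (R : Set (Exp X × Exp Y)) : Prop :=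
  (∀ (A A' : Exp X) (B B' : Exp Y),
      (A, B) ∈ R → A'.carrier ⊆ A.carrier → B.carrier ⊆ B'.carrier → (A', B') ∈ R) ∧
  (∀ A : Exp X, (A, Exp.univ Y) ∈ R) ∧
  (∀ A : Exp X, IsClosed {B : Exp Y | (A, B) ∈ R})

/-- The relation `R^⊣ ⊆ exp Y × exp X`: `(B̃, Ã) ∈ R^⊣` iff for every `A ∈ exp X` with
`A ∩ Ã = ∅` there exists `B ∈ AR` with `B ∩ B̃ = ∅`. -/
def sms (R : Set (Exp X × Exp Y)) : Set (Exp Y × Exp X) :=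
  {p | ∀ A : Exp X, A.carrier ∩ p.2.carrier = ∅ →
      ∃ B : Exp Y, (A, B) ∈ R ∧ B.carrier ∩ p.1.carrier = ∅}

/-- A strict ambiguous representation: additionally all sets `RB = {A | (A,B) ∈ R}`
are closed. -/
def IsStrictAmbRep [Nonempty Y] (R : Set (Exp X × Exp Y)) : Prop :=
  IsAmbRep R ∧ ∀ B : Exp Y, IsClosed {A : Exp X | (A, B) ∈ R}

/-- An open ambiguous representation: strict, pseudo-invertible, and `R^⊣` is strict. -/
def IsOpenAmbRep [Nonempty X] [Nonempty Y] (R : Set (Exp X × Exp Y)) : Prop :=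
  IsStrictAmbRep R ∧ sms (sms R) = R ∧ IsStrictAmbRep (sms R)

/-- The composition `R ⊚ S`: `A (R ⊚ S)` is the closure of
`{C | ∃ B, (A,B) ∈ R ∧ (B,C) ∈ S}`. -/
def bcomp (R : Set (Exp X × Exp Y)) (S : Set (Exp Y × Exp Z)) : Set (Exp X × Exp Z) :=
  {p | p.2 ∈ closure {C : Exp Z | ∃ B : Exp Y, (p.1, B) ∈ R ∧ (B, C) ∈ S}}

/-- The relational composition of `R` and `S`. -/
def rcomp (R : Set (Exp X × Exp Y)) (S : Set (Exp Y × Exp Z)) : Set (Exp X × Exp Z) :=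
  {p | ∃ B : Exp Y, (p.1, B) ∈ R ∧ (B, p.2) ∈ S}

end AmbiguousRepresentations

/-- The set of all strict ambiguous representations between `X` and `Y`, regarded as the
set of those elements of `exp (exp X × exp Y)` that contain `exp X × {Y}` and are antitone
in the first and isotone in the second argument. -/
def SARset (X Y : Type*) [TopologicalSpace X] [TopologicalSpace Y] [Nonempty Y] :
    Set (Exp (Exp X × Exp Y)) :=
  {F | (∀ A : Exp X, ((A, Exp.univ Y) : Exp X × Exp Y) ∈ F.carrier) ∧
       ∀ (A A' : Exp X) (B B' : Exp Y),
         (A, B) ∈ F.carrier → A'.carrier ⊆ A.carrier → B.carrier ⊆ B'.carrier →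
           (A', B') ∈ F.carrier}

namespace Exp

section Topology

variable {X : Type*} [TopologicalSpace X]

theorem carrier_injective : Function.Injective (carrier : Exp X → Set X) := by
  rintro ⟨A, _, _⟩ ⟨B, _, _⟩ h
  cases h
  rfl

theorem isOpen_subset {U : Set X} (hU : IsOpen U) : IsOpen {F : Exp X | F.carrier ⊆ U} :=
  TopologicalSpace.isOpen_generateFrom_of_mem (.inl ⟨U, hU, rfl⟩)

theorem isOpen_inter_nonempty {U : Set X} (hU : IsOpen U) :
    IsOpen {F : Exp X | (F.carrier ∩ U).Nonempty} :=
  TopologicalSpace.isOpen_generateFrom_of_mem (.inr ⟨U, hU, rfl⟩)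

theorem isClosed_mem [T1Space X] (x : X) : IsClosed {F : Exp X | x ∈ F.carrier} := by
  rw [← isOpen_compl_iff]
  convert isOpen_subset (isOpen_compl_singleton (x := x)) using 1
  ext F
  simp [subset_compl_singleton_iff]

theorem topologicalSpace_eq_induced :
    (topologicalSpace : TopologicalSpace (Exp X)) = .induced carrier (.vietoris X) := by
  rw [TopologicalSpace.vietoris, induced_generateFrom_eq]
  unfold topologicalSpace
  congr 1
  ext S
  simp only [mem_union, mem_ofPred_eq, mem_image]
  constructor
  · rintro (⟨U, hU, rfl⟩ | ⟨U, hU, rfl⟩)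
    · exact ⟨_, .inl ⟨U, hU, rfl⟩, rfl⟩
    · exact ⟨_, .inr ⟨U, hU, rfl⟩, rfl⟩
  · rintro ⟨_, ⟨U, hU, rfl⟩ | ⟨U, hU, rfl⟩, rfl⟩
    · exact .inl ⟨U, hU, rfl⟩
    · exact .inr ⟨U, hU, rfl⟩

/-- Basic Vietoris neighborhoods of `F` are the sets of all `G ⊆ ⋃₀ u` that meet every member
of a finite family `u` of open sets. -/
theorem exists_basic_subset_of_mem_nhds {F : Exp X} {N : Set (Exp X)} (hN : N ∈ 𝓝 F) :
    ∃ u : Set (Set X), u.Finite ∧ (∀ U ∈ u, IsOpen U) ∧ F.carrier ⊆ ⋃₀ u ∧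
      (∀ U ∈ u, (F.carrier ∩ U).Nonempty) ∧
      ∀ G : Exp X, G.carrier ⊆ ⋃₀ u → (∀ U ∈ u, (G.carrier ∩ U).Nonempty) → G ∈ N := by
  let := TopologicalSpace.vietoris X
  have hind : IsInducing (carrier : Exp X → Set X) := ⟨topologicalSpace_eq_induced⟩
  obtain ⟨_, ⟨_, ⟨u, ⟨hu, huo⟩, rfl⟩, rfl⟩, hF, hsub⟩ :=
    (TopologicalSpace.vietoris.isTopologicalBasis.isInducing hind).mem_nhds_iff.mp hN
  exact ⟨u, hu, huo, hF.1, hF.2, fun G h₁ h₂ => hsub ⟨h₁, h₂⟩⟩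

theorem isOpen_basic {u : Set (Set X)} (hu : u.Finite) (huo : ∀ U ∈ u, IsOpen U) :
    IsOpen {G : Exp X | G.carrier ⊆ ⋃₀ u ∧ ∀ U ∈ u, (G.carrier ∩ U).Nonempty} := by
  simp_rw [ofPred_and, ofPred_forall]
  exact (isOpen_subset (isOpen_sUnion huo)).inter
    (hu.isOpen_biInter fun U hU => isOpen_inter_nonempty (huo U hU))

/-- On a compactum, `Exp X` is homeomorphic to the hyperspace `NonemptyCompacts X`. -/
def homeomorphNonemptyCompacts [CompactSpace X] [T2Space X] :
    Exp X ≃ₜ TopologicalSpace.NonemptyCompacts X :=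
  Equiv.toHomeomorphOfIsInducing
    { toFun := fun F => ⟨⟨F.carrier, F.isClosed'.isCompact⟩, F.nonempty'⟩
      invFun := fun K => ⟨K, K.isCompact.isClosed, K.nonempty⟩
      left_inv := fun _ => rfl
      right_inv := fun _ => rfl }
    ⟨by
      rw [topologicalSpace_eq_induced]
      unfold TopologicalSpace.NonemptyCompacts.topology
      rw [induced_compose]
      rfl⟩

instance [CompactSpace X] [T2Space X] : CompactSpace (Exp X) :=
  homeomorphNonemptyCompacts.symm.compactSpace

instance [CompactSpace X] [T2Space X] : T2Space (Exp X) :=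
  homeomorphNonemptyCompacts.symm.t2Space

theorem eventually_exists_subset_mem [T1Space X] {A A' : Exp X} (h : A'.carrier ⊆ A.carrier)
    {V : Set (Exp X)} (hV : V ∈ 𝓝 A') :
    ∀ᶠ C in 𝓝 A, ∃ C' ∈ V, C'.carrier ⊆ C.carrier := by
  obtain ⟨u, hu, huo, hsub, hmeet, huV⟩ := exists_basic_subset_of_mem_nhds hV
  have hev : ∀ᶠ C : Exp X in 𝓝 A, ∀ U ∈ u, (C.carrier ∩ U).Nonempty :=
    (hu.eventually_all).mpr fun U hU =>
      (isOpen_inter_nonempty (huo U hU)).mem_nhds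
        ((hmeet U hU).mono (inter_subset_inter_left U h))
  filter_upwards [hev] with C hC
  obtain ⟨x, hx⟩ := A'.nonempty'
  have : Nonempty X := ⟨x⟩
  choose! f hfC hfU using hC
  obtain ⟨W, hW, -⟩ := hsub hx
  refine ⟨⟨f '' u, (hu.image f).isClosed, ⟨f W, W, hW, rfl⟩⟩, huV _ ?_ ?_, ?_⟩
  · rintro _ ⟨U, hU, rfl⟩
    exact ⟨U, hU, hfU U hU⟩
  · exact fun U hU => ⟨f U, ⟨U, hU, rfl⟩, hfU U hU⟩
  · rintro _ ⟨U, hU, rfl⟩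
    exact hfC U hU

theorem eventually_exists_superset_mem {B B' : Exp X} (h : B.carrier ⊆ B'.carrier)
    {V : Set (Exp X)} (hV : V ∈ 𝓝 B') :
    ∀ᶠ D in 𝓝 B, ∃ D' ∈ V, D.carrier ⊆ D'.carrier := by
  obtain ⟨u, hu, huo, hsub, hmeet, huV⟩ := exists_basic_subset_of_mem_nhds hV
  filter_upwards [(isOpen_subset (isOpen_sUnion huo)).mem_nhds (h.trans hsub)] with D hD
  exact ⟨D.union B', huV _ (union_subset hD hsub)
    (fun U hU => (hmeet U hU).mono (inter_subset_inter_left U subset_union_right)),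
    subset_union_left⟩

theorem exists_mem_nhds_union_mem {F : Exp X} {N : Set (Exp X)} (hN : N ∈ 𝓝 F) :
    ∃ V ∈ 𝓝 F, V ⊆ N ∧ ∀ a ∈ V, ∀ b ∈ V, a.union b ∈ V := by
  obtain ⟨u, hu, huo, hsub, hmeet, huN⟩ := exists_basic_subset_of_mem_nhds hN
  refine ⟨_, (isOpen_basic hu huo).mem_nhds ⟨hsub, hmeet⟩, fun G hG => huN G hG.1 hG.2, ?_⟩
  exact fun a ha b hb => ⟨union_subset ha.1 hb.1, fun U hU =>
    (ha.2 U hU).mono (inter_subset_inter_left U subset_union_left)⟩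

end Topology

end Exp

section StrictAmbiguousRepresentations

variable {X Y : Type*} [TopologicalSpace X] [TopologicalSpace Y]

theorem isClosed_setOf_antitone_isotone [CompactSpace X] [T2Space X] [CompactSpace Y] [T2Space Y] :
    IsClosed {F : Exp (Exp X × Exp Y) | ∀ (C C' : Exp X) (D D' : Exp Y),
      (C, D) ∈ F.carrier → C'.carrier ⊆ C.carrier → D.carrier ⊆ D'.carrier →
        (C', D') ∈ F.carrier} := by
  rw [← isOpen_compl_iff, isOpen_iff_mem_nhds]
  intro F hF
  simp only [mem_compl_iff, mem_ofPred_eq, not_forall] at hF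
  obtain ⟨A, A', B, B', hF, hA, hB, hF'⟩ := hF
  obtain ⟨K, hK, hKc, hKF⟩ :=
    exists_mem_nhds_isClosed_subset (F.isClosed'.isOpen_compl.mem_nhds hF')
  obtain ⟨V, hV, W, hW, hVW⟩ := mem_nhds_prod_iff.mp hK
  obtain ⟨O, hO, hOo, hABO⟩ := mem_nhds_iff.mp
    ((Exp.eventually_exists_subset_mem hA hV).prod_nhds (Exp.eventually_exists_superset_mem hB hW))
  filter_upwards [(Exp.isOpen_inter_nonempty hOo).mem_nhds ⟨_, hF, hABO⟩,
    (Exp.isOpen_subset hKc.isOpen_compl).mem_nhds (subset_compl_comm.mp hKF)]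
  rintro G ⟨⟨C, D⟩, hCD, hCDO⟩ hGK hG
  obtain ⟨⟨C', hC'V, hC'⟩, D', hD'W, hD'⟩ := hO hCDO
  exact hGK (hG C C' D D' hCD hC' hD') (hVW ⟨hC'V, hD'W⟩)

theorem isClosed_SARset [CompactSpace X] [T2Space X] [CompactSpace Y] [T2Space Y] [Nonempty Y] :
    IsClosed (SARset X Y) := by
  unfold SARset
  rw [ofPred_and, ofPred_forall]
  exact (isClosed_iInter fun A => Exp.isClosed_mem _).inter isClosed_setOf_antitone_isotone

theorem union_mem_SARset [Nonempty Y] {F G : Exp (Exp X × Exp Y)}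
    (hF : F ∈ SARset X Y) (hG : G ∈ SARset X Y) : F.union G ∈ SARset X Y :=
  ⟨fun A => .inl (hF.1 A), fun A A' B B' h hA hB =>
    h.imp (fun h => hF.2 A A' B B' h hA hB) (fun h => hG.2 A A' B B' h hA hB)⟩

end StrictAmbiguousRepresentations

/-- The set of strict ambiguous representations between compacta `X` and `Y` is a closed
subset of `exp (exp X × exp Y)`, is closed under binary unions, and is a compact Lawson
upper semilattice: it is compact and each of its points has arbitrarily small neighborhoods
(within the set) that are upper subsemilattices. -/
theorem statement15 {X Y : Type*}
    [TopologicalSpace X] [CompactSpace X] [T2Space X] [Nonempty X]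
    [TopologicalSpace Y] [CompactSpace Y] [T2Space Y] [Nonempty Y] :
    IsClosed (SARset X Y) ∧
    (∀ F ∈ SARset X Y, ∀ G ∈ SARset X Y, Exp.union F G ∈ SARset X Y) ∧
    IsCompact (SARset X Y) ∧
    (∀ F ∈ SARset X Y, ∀ N ∈ nhdsWithin F (SARset X Y),
      ∃ V ∈ nhdsWithin F (SARset X Y), V ⊆ N ∧
        ∀ a ∈ V ∩ SARset X Y, ∀ b ∈ V ∩ SARset X Y, Exp.union a b ∈ V) := by
  refine ⟨isClosed_SARset, fun F hF G hG => union_mem_SARset hF hG, isClosed_SARset.isCompact,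
    fun F hF N hN => ?_⟩
  obtain ⟨M, hM, hMN⟩ := mem_nhdsWithin_iff_exists_mem_nhds_inter.mp hN
  obtain ⟨V, hV, hVM, hVunion⟩ := Exp.exists_mem_nhds_union_mem hM
  exact ⟨V ∩ SARset X Y, Filter.inter_mem (mem_nhdsWithin_of_mem_nhds hV) self_mem_nhdsWithin,
    (inter_subset_inter_left _ hVM).trans hMN, fun a ha b hb =>
      ⟨hVunion a ha.1.1 b hb.1.1, union_mem_SARset ha.2 hb.2⟩⟩
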